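/- Let k ≥ 1 and n > k. The Gaussian binomial coefficient satisfies the product formula binom(n,k)_q = ∏_{j=2}^{n} Φ_j(q)^{e_j}, where e_j = ⌊n/j⌋ - ⌊k/j⌋ - ⌊(n-k)/j⌋ ∈ {0,1}; in particular Φ_j(q) divides binom(n,k)_q if and only if ⌊n/j⌋ > ⌊k/j⌋ + ⌊(n-k)/j⌋. -/

import Mathlib

open Polynomial Finset

/-- Numerator of the Gaussian binomial coefficient: `∏_{i=0}^{k-1} (1 - q^{n-i})`. -/
noncomputable def gaussNum (n k : ℕ) : Polynomial ℤ :=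
  ∏ i ∈ Finset.range k, (1 - X ^ (n - i))

/-- Denominator of the Gaussian binomial coefficient: `∏_{i=1}^{k} (1 - q^i)`. -/
noncomputable def gaussDen (k : ℕ) : Polynomial ℤ :=
  ∏ i ∈ Finset.range k, (1 - X ^ (i + 1))

theorem gaussNum_mul_gaussDen (n k : ℕ) (h : k ≤ n) :
    gaussNum n k * gaussDen (n - k) = gaussDen n := by
  induction k with
  | zero => simp [gaussNum]
  | succ k ih =>
    rw [← ih (by omega)]
    obtain ⟨m, rfl⟩ : ∃ m, n = m + (k + 1) := ⟨n - (k + 1), by omega⟩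
    have h1 : m + (k + 1) - (k + 1) = m := by omega
    have h2 : m + (k + 1) - k = m + 1 := by omega
    rw [h1, h2]
    unfold gaussNum gaussDen
    rw [Finset.prod_range_succ, Finset.prod_range_succ _ m, h2]
    ring

theorem gaussDen_eq (N m : ℕ) (h : m ≤ N) :
    gaussDen m = (-1) ^ m * ∏ j ∈ Finset.Icc 1 N, cyclotomic j ℤ ^ (m / j) := by
  induction m with
  | zero => simp [gaussDen]
  | succ m ih =>
    have h1 : gaussDen (m + 1) = gaussDen m * (1 - X ^ (m + 1)) := by
      unfold gaussDen
      rw [Finset.prod_range_succ]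
    have h2 : (X ^ (m + 1) - 1 : ℤ[X]) =
        ∏ j ∈ Finset.Icc 1 N, if j ∣ m + 1 then cyclotomic j ℤ else 1 := by
      rw [← prod_cyclotomic_eq_X_pow_sub_one (Nat.succ_pos m), ← Finset.prod_filter]
      apply Finset.prod_congr _ (fun _ _ => rfl)
      ext j
      simp only [Nat.mem_divisors, Finset.mem_filter, Finset.mem_Icc]
      constructor
      · rintro ⟨hd, -⟩
        exact ⟨⟨Nat.pos_of_dvd_of_pos hd (Nat.succ_pos m),
          (Nat.le_of_dvd (Nat.succ_pos m) hd).trans h⟩, hd⟩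
      · rintro ⟨-, hd⟩
        exact ⟨hd, by omega⟩
    have h3 : ∏ j ∈ Finset.Icc 1 N, cyclotomic j ℤ ^ ((m + 1) / j) =
        (∏ j ∈ Finset.Icc 1 N, cyclotomic j ℤ ^ (m / j)) * (X ^ (m + 1) - 1) := by
      rw [h2, ← Finset.prod_mul_distrib]
      apply Finset.prod_congr rfl
      intro j _
      rw [Nat.succ_div]
      split_ifs
      · rw [pow_succ]
      · simp
    rw [h1, h3, ih (by omega)]
    ring

theorem floor_facts (n k j : ℕ) (hkn : k < n) (hj : 0 < j) :
    k / j + (n - k) / j ≤ n / j ∧ n / j ≤ k / j + (n - k) / j + 1 := by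
  have h := Nat.add_div (a := k) (b := n - k) hj
  rw [Nat.add_sub_cancel' hkn.le] at h
  split_ifs at h <;> omega

theorem gaussDen_ne_zero (m : ℕ) : gaussDen m ≠ 0 := by
  rw [gaussDen_eq m m le_rfl]
  refine mul_ne_zero (pow_ne_zero _ (by simp)) (Finset.prod_ne_zero_iff.2 ?_)
  intro j _
  exact pow_ne_zero _ (cyclotomic_ne_zero j ℤ)

/-- For `1 ≤ k < n`, the Gaussian binomial coefficient factors as
`binom(n,k)_q = ∏_{j=2}^{n} Φ_j(q)^{e_j}` with `e_j = ⌊n/j⌋ - ⌊k/j⌋ - ⌊(n-k)/j⌋ ∈ {0,1}`;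
in particular `Φ_j(q) ∣ binom(n,k)_q` iff `⌊n/j⌋ > ⌊k/j⌋ + ⌊(n-k)/j⌋`. -/
theorem gaussian_binomial_cyclotomic_factorization (n k : ℕ) (hk1 : 1 ≤ k) (hkn : k < n)
    (P : Polynomial ℤ) (hP : P * gaussDen k = gaussNum n k) :
    P = ∏ j ∈ Finset.Icc 2 n, cyclotomic j ℤ ^ (n / j - k / j - (n - k) / j) ∧
    (∀ j ∈ Finset.Icc 2 n, n / j - k / j - (n - k) / j ≤ 1) ∧
    (∀ j ∈ Finset.Icc 2 n, (cyclotomic j ℤ ∣ P ↔ k / j + (n - k) / j < n / j)) := by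
  have hPeq : P = ∏ j ∈ Finset.Icc 2 n, cyclotomic j ℤ ^ (n / j - k / j - (n - k) / j) := by
    have h1 : P * (gaussDen k * gaussDen (n - k)) = gaussDen n := by
      rw [← mul_assoc, hP, gaussNum_mul_gaussDen n k hkn.le]
    apply mul_right_cancel₀ (mul_ne_zero (gaussDen_ne_zero k) (gaussDen_ne_zero (n - k)))
    rw [h1]
    have h2 : ∏ j ∈ Finset.Icc 2 n, cyclotomic j ℤ ^ (n / j - k / j - (n - k) / j) =
        ∏ j ∈ Finset.Icc 1 n, cyclotomic j ℤ ^ (n / j - k / j - (n - k) / j) := by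
      apply Finset.prod_subset (Finset.Icc_subset_Icc_left (by norm_num))
      intro j hj hj'
      have : j = 1 := by
        simp only [Finset.mem_Icc] at hj hj'
        omega
      subst this
      simp
    rw [h2, gaussDen_eq n n le_rfl, gaussDen_eq n k hkn.le, gaussDen_eq n (n - k) (by omega)]
    have h3 : ∏ j ∈ Finset.Icc 1 n, cyclotomic j ℤ ^ (n / j) =
        (∏ j ∈ Finset.Icc 1 n, cyclotomic j ℤ ^ (n / j - k / j - (n - k) / j)) *
        ((∏ j ∈ Finset.Icc 1 n, cyclotomic j ℤ ^ (k / j)) *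
          ∏ j ∈ Finset.Icc 1 n, cyclotomic j ℤ ^ ((n - k) / j)) := by
      rw [← Finset.prod_mul_distrib, ← Finset.prod_mul_distrib]
      apply Finset.prod_congr rfl
      intro j hj
      have := floor_facts n k j hkn (Finset.mem_Icc.1 hj).1
      rw [← pow_add, ← pow_add]
      congr 1
      omega
    have h4 : ((-1) ^ n : ℤ[X]) = (-1) ^ k * (-1) ^ (n - k) := by
      rw [← pow_add, Nat.add_sub_cancel' hkn.le]
    rw [h3, h4]
    ring
  refine ⟨hPeq, ?_, ?_⟩
  · intro j hj
    have := floor_facts n k j hkn (by have := (Finset.mem_Icc.1 hj).1; omega)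
    omega
  · intro j hj
    have hj0 : 0 < j := by
      have := (Finset.mem_Icc.1 hj).1
      omega
    constructor
    · intro hd
      rw [hPeq] at hd
      have hp : Prime (cyclotomic j ℤ) := (cyclotomic.irreducible hj0).prime
      obtain ⟨i, hi, hdi⟩ := (hp.dvd_finset_prod_iff _).1 hd
      have hi0 : 0 < i := by
        have := (Finset.mem_Icc.1 hi).1
        omega
      have he : n / i - k / i - (n - k) / i ≠ 0 := by
        intro h0
        rw [h0, pow_zero] at hdi
        exact hp.not_unit (isUnit_of_dvd_one hdi)
      have hdi' := hp.dvd_of_dvd_pow hdi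
      have hassoc := hp.irreducible.associated_of_dvd (cyclotomic.irreducible hi0) hdi'
      have heq := eq_of_monic_of_associated (cyclotomic.monic j ℤ) (cyclotomic.monic i ℤ) hassoc
      have hji : j = i := cyclotomic_injective heq
      subst hji
      omega
    · intro hlt
      rw [hPeq]
      refine dvd_trans (dvd_pow_self _ ?_) (Finset.dvd_prod_of_mem _ hj)
      omega
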